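/- Let α : ℝ² → ℝ be a smooth bounded function with finite Dirichlet energy ∫_{ℝ²} |∇α(z)|² dz < ∞ satisfying the eigenfunction equation Δα(z) + (8/(1+|z|²)²) α(z) = 0 for all z ∈ ℝ². Then there exist real constants c₀, c₁, c₂ such that α = c₀ ψ₀ + c₁ ψ₁ + c₂ ψ₂ on ℝ². -/

import Mathlib

open MeasureTheory

noncomputable section

/-- First partial derivative (in the `x` direction) of a map on `ℝ²`. -/
def pd1 {E : Type*} [NormedAddCommGroup E] [NormedSpace ℝ E]
    (f : ℝ × ℝ → E) (z : ℝ × ℝ) : E :=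
  fderiv ℝ f z (1, 0)

/-- Second partial derivative (in the `y` direction) of a map on `ℝ²`. -/
def pd2 {E : Type*} [NormedAddCommGroup E] [NormedSpace ℝ E]
    (f : ℝ × ℝ → E) (z : ℝ × ℝ) : E :=
  fderiv ℝ f z (0, 1)

/-- Flat Laplacian `Δf = f_xx + f_yy` on `ℝ²`. -/
def lap {E : Type*} [NormedAddCommGroup E] [NormedSpace ℝ E]
    (f : ℝ × ℝ → E) (z : ℝ × ℝ) : E :=
  pd1 (pd1 f) z + pd2 (pd2 f) z

/-- `|∇f|² = |f_x|² + |f_y|²`. -/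
def gradSq {E : Type*} [NormedAddCommGroup E] [NormedSpace ℝ E]
    (f : ℝ × ℝ → E) (z : ℝ × ℝ) : ℝ :=
  ‖pd1 f z‖ ^ 2 + ‖pd2 f z‖ ^ 2

/-- The inverse stereographic projection `ω : ℝ² → ℝ³`. -/
def stereo (z : ℝ × ℝ) : EuclideanSpace ℝ (Fin 3) :=
  (WithLp.equiv 2 (Fin 3 → ℝ)).symm
    ![2 * z.1 / (1 + z.1 ^ 2 + z.2 ^ 2),
      2 * z.2 / (1 + z.1 ^ 2 + z.2 ^ 2),
      (z.1 ^ 2 + z.2 ^ 2 - 1) / (1 + z.1 ^ 2 + z.2 ^ 2)]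

/-- `ψ₀(x,y) = (1−x²−y²)/(1+x²+y²)`. -/
def psi0 (z : ℝ × ℝ) : ℝ := (1 - z.1 ^ 2 - z.2 ^ 2) / (1 + z.1 ^ 2 + z.2 ^ 2)

/-- `ψ₁(x,y) = x/(1+x²+y²)`. -/
def psi1 (z : ℝ × ℝ) : ℝ := z.1 / (1 + z.1 ^ 2 + z.2 ^ 2)

/-- `ψ₂(x,y) = y/(1+x²+y²)`. -/
def psi2 (z : ℝ × ℝ) : ℝ := z.2 / (1 + z.1 ^ 2 + z.2 ^ 2)

open Real in
/-- radial bump -/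
def bmp (z : ℝ × ℝ) : ℝ := Real.smoothTransition (2 - (z.1 ^ 2 + z.2 ^ 2))

lemma bmp_smooth : ContDiff ℝ (⊤ : ℕ∞) bmp := by
  unfold bmp
  exact Real.smoothTransition.contDiff.comp (by fun_prop)

lemma bmp_cont : Continuous bmp := bmp_smooth.continuous

lemma bmp_supp : HasCompactSupport bmp := by
  refine HasCompactSupport.of_support_subset_isCompact
    (K := Set.Icc (-2) 2 ×ˢ Set.Icc (-2) 2) (isCompact_Icc.prod isCompact_Icc) ?_
  intro z hz
  by_contra h
  apply hz
  refine Real.smoothTransition.zero_of_nonpos ?_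
  by_contra h2
  apply h
  have h3 : z.1 ^ 2 + z.2 ^ 2 < 2 := by linarith
  refine ⟨⟨?_, ?_⟩, ⟨?_, ?_⟩⟩ <;> nlinarith [sq_nonneg z.1, sq_nonneg z.2]

lemma bmp_int_pos : 0 < ∫ z, bmp z := by
  refine bmp_cont.integral_pos_of_hasCompactSupport_nonneg_nonzero bmp_supp
    (fun z => Real.smoothTransition.nonneg _) (x := 0) ?_
  unfold bmp
  rw [Real.smoothTransition.one_of_one_le] <;> norm_num

lemma polar_int (g : ℝ × ℝ → ℂ) (hg : Continuous g) :
    ∫ z, (bmp z : ℂ) * g z = ∫ r in Set.Ioi (0:ℝ), ((r * Real.smoothTransition (2 - r ^ 2) : ℝ) : ℂ) *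
      ∫ θ in (-Real.pi)..Real.pi, g (r * Real.cos θ, r * Real.sin θ) := by
  rw [← integral_comp_polarCoord_symm]
  rw [polarCoord_target, Measure.volume_eq_prod, setIntegral_prod]
  · refine integral_congr_ae (Filter.Eventually.of_forall fun r => ?_)
    simp only
    rw [intervalIntegral.integral_of_le (by linarith [Real.pi_pos]), ← integral_Ioc_eq_integral_Ioo,
      ← integral_const_mul]
    refine integral_congr_ae (Filter.Eventually.of_forall fun θ => ?_)
    simp only [polarCoord_symm_apply, bmp]
    have : (r * Real.cos θ) ^ 2 + (r * Real.sin θ) ^ 2 = r ^ 2 := by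
      have := Real.sin_sq_add_cos_sq θ
      linear_combination r ^ 2 * this
    rw [this]
    simp only [Complex.real_smul]
    push_cast
    ring
  · have hc : Continuous (fun p : ℝ × ℝ => p.1 • ((bmp (polarCoord.symm p) : ℂ) * g (polarCoord.symm p))) := by
      have h1 := continuous_polarCoord_symm
      have h2 := bmp_cont
      fun_prop
    have h := (hc.continuousOn (s := Set.Icc 0 2 ×ˢ Set.Icc (-Real.pi) Real.pi)).integrableOn_compact
      (μ := volume) (isCompact_Icc.prod isCompact_Icc)
    refine IntegrableOn.of_forall_sdiff_eq_zero h (measurableSet_Ioi.prod measurableSet_Ioo) ?_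
    rintro ⟨r, θ⟩ ⟨⟨hr, hθ⟩, hn⟩
    have hr2 : 2 < r := by
      by_contra h3
      exact hn ⟨⟨le_of_lt hr, not_lt.1 h3⟩, ⟨hθ.1.le, hθ.2.le⟩⟩
    have : bmp (polarCoord.symm (r, θ)) = 0 := by
      simp only [polarCoord_symm_apply, bmp]
      apply Real.smoothTransition.zero_of_nonpos
      have h5 : (r * Real.cos θ) ^ 2 + (r * Real.sin θ) ^ 2 = r ^ 2 := by
        have := Real.sin_sq_add_cos_sq θ
        linear_combination r ^ 2 * this
      rw [h5]
      nlinarith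
    simp only [this]
    simp

lemma circ (H : ℂ → ℂ) (hH : Differentiable ℂ H) (r : ℝ) :
    ∫ θ in (-Real.pi)..Real.pi, H ((r * Real.cos θ : ℝ) + (r * Real.sin θ : ℝ) * Complex.I)
      = 2 * Real.pi * H 0 := by
  have h := DiffContOnCl.circleAverage (f := H) (c := 0) (R := r) hH.diffContOnCl
  have h2 : Function.Periodic (fun θ => H (circleMap 0 r θ)) (2 * Real.pi) := fun θ => by
    simp only [periodic_circleMap 0 r θ]
  have h3 := h2.intervalIntegral_add_eq (-Real.pi) 0
  rw [Real.circleAverage] at h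
  have e1 : -Real.pi + 2 * Real.pi = Real.pi := by ring
  rw [e1, zero_add] at h3
  rw [← h, ← h3]
  have hp : (Real.pi : ℂ) ≠ 0 := by exact_mod_cast Real.pi_ne_zero
  rw [Complex.real_smul]
  push_cast
  rw [← mul_assoc, mul_inv_cancel₀ (by simp), one_mul]
  refine intervalIntegral.integral_congr fun θ _ => ?_
  simp only [circleMap]
  congr 1
  rw [Complex.exp_mul_I]
  push_cast
  ring

lemma mv (H : ℂ → ℂ) (hH : Differentiable ℂ H) :
    ∫ z : ℝ × ℝ, (bmp z : ℂ) * H (z.1 + z.2 * Complex.I) = ((∫ z, bmp z : ℝ) : ℂ) * H 0 := by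
  have hc := hH.continuous
  rw [← integral_complex_ofReal]
  have h1 := polar_int (fun z => H (z.1 + z.2 * Complex.I)) (by fun_prop)
  have h2 := polar_int (fun z => 1) (by fun_prop)
  simp only [mul_one] at h2
  rw [h1, h2, ← integral_mul_const]
  refine integral_congr_ae (Filter.Eventually.of_forall fun r => ?_)
  simp only
  have := circ H hH r
  rw [this, intervalIntegral.integral_const]
  rw [Complex.real_smul]
  push_cast
  ring

lemma ContDiff.d {f : ℝ × ℝ → ℝ} (h : ContDiff ℝ (⊤ : ℕ∞) f) : Differentiable ℝ f := ContDiff.differentiable h (by simp)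

lemma ContDiff.p1 {f : ℝ × ℝ → ℝ} (h : ContDiff ℝ (⊤ : ℕ∞) f) : ContDiff ℝ (⊤ : ℕ∞) (pd1 f) := by
  unfold pd1
  exact (ContDiff.fderiv_right h (m := (⊤ : ℕ∞)) (by simp)).clm_apply contDiff_const

lemma ContDiff.p2 {f : ℝ × ℝ → ℝ} (h : ContDiff ℝ (⊤ : ℕ∞) f) : ContDiff ℝ (⊤ : ℕ∞) (pd2 f) := by
  unfold pd2
  exact (ContDiff.fderiv_right h (m := (⊤ : ℕ∞)) (by simp)).clm_apply contDiff_const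

lemma pd_comm {f : ℝ × ℝ → ℝ} (h : ContDiff ℝ (⊤ : ℕ∞) f) (z) : pd2 (pd1 f) z = pd1 (pd2 f) z := by
  have hs : IsSymmSndFDerivAt ℝ f z := (h.contDiffAt).isSymmSndFDerivAt (by simp; exact WithTop.coe_le_coe.2 (le_top : (2:ℕ∞) ≤ ⊤))
  have hd : DifferentiableAt ℝ (fderiv ℝ f) z :=
    (ContDiff.fderiv_right h (m := (⊤ : ℕ∞)) (by simp)).differentiable (by simp) z
  have e : ∀ v w : ℝ × ℝ, fderiv ℝ (fun y => fderiv ℝ f y v) z w = fderiv ℝ (fderiv ℝ f) z w v := by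
    intro v w
    rw [fderiv_clm_apply hd (by fun_prop)]
    simp
  have := hs (0, 1) (1, 0)
  unfold pd1 pd2
  rw [e, e, this]

lemma pd1_add {f g : ℝ × ℝ → ℝ} (hf : ContDiff ℝ (⊤ : ℕ∞) f) (hg : ContDiff ℝ (⊤ : ℕ∞) g) (z) :
    pd1 (fun y => f y + g y) z = pd1 f z + pd1 g z := by
  simp [pd1, fderiv_fun_add (hf.d z) (hg.d z)]
lemma pd2_add {f g : ℝ × ℝ → ℝ} (hf : ContDiff ℝ (⊤ : ℕ∞) f) (hg : ContDiff ℝ (⊤ : ℕ∞) g) (z) :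
    pd2 (fun y => f y + g y) z = pd2 f z + pd2 g z := by
  simp [pd2, fderiv_fun_add (hf.d z) (hg.d z)]
lemma pd1_sub {f g : ℝ × ℝ → ℝ} (hf : ContDiff ℝ (⊤ : ℕ∞) f) (hg : ContDiff ℝ (⊤ : ℕ∞) g) (z) :
    pd1 (fun y => f y - g y) z = pd1 f z - pd1 g z := by
  simp [pd1, fderiv_fun_sub (hf.d z) (hg.d z)]
lemma pd2_sub {f g : ℝ × ℝ → ℝ} (hf : ContDiff ℝ (⊤ : ℕ∞) f) (hg : ContDiff ℝ (⊤ : ℕ∞) g) (z) :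
    pd2 (fun y => f y - g y) z = pd2 f z - pd2 g z := by
  simp [pd2, fderiv_fun_sub (hf.d z) (hg.d z)]
lemma pd1_mul {f g : ℝ × ℝ → ℝ} (hf : ContDiff ℝ (⊤ : ℕ∞) f) (hg : ContDiff ℝ (⊤ : ℕ∞) g) (z) :
    pd1 (fun y => f y * g y) z = pd1 f z * g z + f z * pd1 g z := by
  simp [pd1, fderiv_fun_mul (hf.d z) (hg.d z)]; ring
lemma pd2_mul {f g : ℝ × ℝ → ℝ} (hf : ContDiff ℝ (⊤ : ℕ∞) f) (hg : ContDiff ℝ (⊤ : ℕ∞) g) (z) :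
    pd2 (fun y => f y * g y) z = pd2 f z * g z + f z * pd2 g z := by
  simp [pd2, fderiv_fun_mul (hf.d z) (hg.d z)]; ring
lemma pd1_const (c : ℝ) (z) : pd1 (fun _ => c) z = 0 := by simp [pd1]
lemma pd2_const (c : ℝ) (z) : pd2 (fun _ => c) z = 0 := by simp [pd2]
lemma pd1_fst (z : ℝ × ℝ) : pd1 (fun y : ℝ × ℝ => y.1) z = 1 := by simp [pd1, fderiv_fst]
lemma pd2_fst (z : ℝ × ℝ) : pd2 (fun y : ℝ × ℝ => y.1) z = 0 := by simp [pd2, fderiv_fst]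
lemma pd1_snd (z : ℝ × ℝ) : pd1 (fun y : ℝ × ℝ => y.2) z = 0 := by simp [pd1, fderiv_snd]
lemma pd2_snd (z : ℝ × ℝ) : pd2 (fun y : ℝ × ℝ => y.2) z = 1 := by simp [pd2, fderiv_snd]

def WW (z : ℝ × ℝ) : ℝ := 1 + z.1 * z.1 + z.2 * z.2
def vv (z : ℝ × ℝ) : ℝ := (WW z)⁻¹

lemma WW_pos (z) : 0 < WW z := by unfold WW; nlinarith [mul_self_nonneg z.1, mul_self_nonneg z.2]
lemma WW_sm : ContDiff ℝ (⊤ : ℕ∞) WW := by unfold WW; fun_prop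
lemma vv_sm : ContDiff ℝ (⊤ : ℕ∞) vv := WW_sm.inv (fun z => (WW_pos z).ne')
lemma fst_sm : ContDiff ℝ (⊤ : ℕ∞) (fun y : ℝ × ℝ => y.1) := contDiff_fst
lemma snd_sm : ContDiff ℝ (⊤ : ℕ∞) (fun y : ℝ × ℝ => y.2) := contDiff_snd
lemma vW (z) : vv z * WW z = 1 := inv_mul_cancel₀ (WW_pos z).ne'

lemma pd1_WW (z) : pd1 WW z = 2 * z.1 := by
  unfold WW
  rw [pd1_add (by fun_prop) (by fun_prop), pd1_add (by fun_prop) (by fun_prop), pd1_const,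
    pd1_mul fst_sm fst_sm, pd1_mul snd_sm snd_sm, pd1_fst, pd1_snd]
  ring
lemma pd2_WW (z) : pd2 WW z = 2 * z.2 := by
  unfold WW
  rw [pd2_add (by fun_prop) (by fun_prop), pd2_add (by fun_prop) (by fun_prop), pd2_const,
    pd2_mul fst_sm fst_sm, pd2_mul snd_sm snd_sm, pd2_fst, pd2_snd]
  ring
lemma pd1_vv (z) : pd1 vv z = - 2 * z.1 * vv z ^ 2 := by
  have h : pd1 (fun y => vv y * WW y) z = 0 := by
    have : (fun y => vv y * WW y) = fun _ => 1 := funext vW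
    rw [this, pd1_const]
  rw [pd1_mul vv_sm WW_sm, pd1_WW] at h
  have := vW z
  linear_combination vv z * h - pd1 vv z * this
lemma pd2_vv (z) : pd2 vv z = - 2 * z.2 * vv z ^ 2 := by
  have h : pd2 (fun y => vv y * WW y) z = 0 := by
    have : (fun y => vv y * WW y) = fun _ => 1 := funext vW
    rw [this, pd2_const]
  rw [pd2_mul vv_sm WW_sm, pd2_WW] at h
  have := vW z
  linear_combination vv z * h - pd2 vv z * this

def UU (α : ℝ × ℝ → ℝ) (z : ℝ × ℝ) : ℝ :=
  (pd1 (pd1 α) z - pd2 (pd2 α) z) + 4 * (vv z * (z.1 * pd1 α z - z.2 * pd2 α z))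
def VV (α : ℝ × ℝ → ℝ) (z : ℝ × ℝ) : ℝ :=
  2 * pd1 (pd2 α) z + 4 * (vv z * (z.1 * pd2 α z + z.2 * pd1 α z))

lemma UU_sm {α} (h : ContDiff ℝ (⊤ : ℕ∞) α) : ContDiff ℝ (⊤ : ℕ∞) (UU α) := by
  have h1 := h.p1; have h2 := h.p2; have h3 := h1.p1; have h4 := h2.p2; have := vv_sm
  unfold UU; fun_prop
lemma VV_sm {α} (h : ContDiff ℝ (⊤ : ℕ∞) α) : ContDiff ℝ (⊤ : ℕ∞) (VV α) := by
  have h1 := h.p1; have h2 := h.p2; have h3 := h2.p1; have := vv_sm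
  unfold VV; fun_prop

lemma fderiv_pd (f : ℝ × ℝ → ℝ) (z v : ℝ × ℝ) : fderiv ℝ f z v = v.1 * pd1 f z + v.2 * pd2 f z := by
  have : v = v.1 • ((1:ℝ), (0:ℝ)) + v.2 • ((0:ℝ), (1:ℝ)) := by ext <;> simp
  conv_lhs => rw [this]
  rw [map_add, map_smul, map_smul]
  rfl

lemma const_of_pd {f : ℝ × ℝ → ℝ} (hf : ContDiff ℝ (⊤ : ℕ∞) f) (h1 : ∀ z, pd1 f z = 0) (h2 : ∀ z, pd2 f z = 0) (z) :
    f z = f 0 := by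
  refine is_const_of_fderiv_eq_zero (𝕜 := ℝ) hf.d (fun y => ?_) z 0
  ext1 <;> ext <;> simp [fderiv_pd, h1, h2]

lemma CR {α : ℝ × ℝ → ℝ} (h : ContDiff ℝ (⊤ : ℕ∞) α)
    (he : ∀ z, pd1 (pd1 α) z + pd2 (pd2 α) z = - 8 * (vv z * vv z * α z)) (z) :
    pd1 (UU α) z = - pd2 (VV α) z ∧ pd2 (UU α) z = pd1 (VV α) z := by
  have h1 := h.p1; have h2 := h.p2; have h11 := h1.p1; have h22 := h2.p2; have h12 := h2.p1
  have hv := vv_sm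
  have hf := fst_sm
  have hs := snd_sm
  have hfe : (fun z => pd1 (pd1 α) z + pd2 (pd2 α) z) = fun z => - 8 * (vv z * vv z * α z) :=
    funext he
  have hA : pd1 (pd1 (pd1 α)) z + pd1 (pd2 (pd2 α)) z =
      - 8 * ((pd1 vv z * vv z + vv z * pd1 vv z) * α z + vv z * vv z * pd1 α z) := by
    rw [← pd1_add h11 h22, hfe, pd1_mul (by fun_prop) (by fun_prop), pd1_const,
      pd1_mul (by fun_prop) (by fun_prop), pd1_mul (by fun_prop) (by fun_prop)]
    ring
  have hB : pd2 (pd1 (pd1 α)) z + pd2 (pd2 (pd2 α)) z =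
      - 8 * ((pd2 vv z * vv z + vv z * pd2 vv z) * α z + vv z * vv z * pd2 α z) := by
    rw [← pd2_add h11 h22, hfe, pd2_mul (by fun_prop) (by fun_prop), pd2_const,
      pd2_mul (by fun_prop) (by fun_prop), pd2_mul (by fun_prop) (by fun_prop)]
    ring
  have hc1 : pd2 (pd1 α) = pd1 (pd2 α) := funext (pd_comm h)
  have hc2 : pd2 (pd1 (pd1 α)) z = pd1 (pd1 (pd2 α)) z := by rw [pd_comm h1, hc1]
  have hc3 : pd2 (pd1 (pd2 α)) z = pd1 (pd2 (pd2 α)) z := by rw [pd_comm h2]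
  have hz := he z
  have hw := vW z
  simp only [WW] at hw
  rw [hc2] at hB
  simp only [pd1_vv, pd2_vv] at hA hB
  unfold UU VV
  constructor
  · rw [pd1_add (by fun_prop) (by fun_prop), pd1_sub h11 h22, pd1_mul (by fun_prop) (by fun_prop),
      pd1_mul (by fun_prop) (by fun_prop), pd1_sub (by fun_prop) (by fun_prop),
      pd1_mul (by fun_prop) (by fun_prop), pd1_mul (by fun_prop) (by fun_prop),
      pd2_add (by fun_prop) (by fun_prop), pd2_mul (by fun_prop) (by fun_prop),
      pd2_mul (by fun_prop) (by fun_prop),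
      pd2_mul (by fun_prop) (by fun_prop), pd2_add (by fun_prop) (by fun_prop),
      pd2_mul (by fun_prop) (by fun_prop), pd2_mul (by fun_prop) (by fun_prop)]
    simp only [pd1_const, pd2_const, pd1_fst, pd2_fst, pd1_snd, pd2_snd, pd1_vv, pd2_vv, hc1, hc3]
    linear_combination hA + 4 * vv z * z.1 * hz - 8 * vv z * pd1 α z * hw
  · rw [pd2_add (by fun_prop) (by fun_prop), pd2_sub h11 h22, pd2_mul (by fun_prop) (by fun_prop),
      pd2_mul (by fun_prop) (by fun_prop), pd2_sub (by fun_prop) (by fun_prop),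
      pd2_mul (by fun_prop) (by fun_prop), pd2_mul (by fun_prop) (by fun_prop),
      pd1_add (by fun_prop) (by fun_prop), pd1_mul (by fun_prop) (by fun_prop),
      pd1_mul (by fun_prop) (by fun_prop),
      pd1_mul (by fun_prop) (by fun_prop), pd1_add (by fun_prop) (by fun_prop),
      pd1_mul (by fun_prop) (by fun_prop), pd1_mul (by fun_prop) (by fun_prop)]
    simp only [pd1_const, pd2_const, pd1_fst, pd2_fst, pd1_snd, pd2_snd, pd1_vv, pd2_vv, hc1, hc2]
    linear_combination - hB - 4 * vv z * z.2 * hz + 8 * vv z * pd2 α z * hw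

lemma final {α : ℝ × ℝ → ℝ} (h : ContDiff ℝ (⊤ : ℕ∞) α)
    (he : ∀ z, pd1 (pd1 α) z + pd2 (pd2 α) z = - 8 * (vv z * vv z * α z))
    (hU : ∀ z, UU α z = 0) (hV : ∀ z, VV α z = 0) :
    ∃ a b c : ℝ, ∀ z, WW z * α z = a * (z.1 * z.1 + z.2 * z.2 - 1) + b * z.1 + c * z.2 := by
  have h1 := h.p1; have h2 := h.p2; have h11 := h1.p1; have h22 := h2.p2; have h12 := h2.p1
  have hW := WW_sm
  have hf := fst_sm
  have hs := snd_sm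
  obtain ⟨β, hβd⟩ : ∃ β : ℝ × ℝ → ℝ, β = fun z => WW z * α z := ⟨_, rfl⟩
  have hβ : ContDiff ℝ (⊤ : ℕ∞) β := by rw [hβd]; fun_prop
  have b1 : pd1 β = fun z => 2 * z.1 * α z + WW z * pd1 α z := by
    ext z; rw [hβd, pd1_mul hW h, pd1_WW]
  have b2 : pd2 β = fun z => 2 * z.2 * α z + WW z * pd2 α z := by
    ext z; rw [hβd, pd2_mul hW h, pd2_WW]
  have b11 : ∀ z, pd1 (pd1 β) z = 2 * α z + 4 * z.1 * pd1 α z + WW z * pd1 (pd1 α) z := by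
    intro z
    rw [b1, pd1_add (by fun_prop) (by fun_prop), pd1_mul (by fun_prop) (by fun_prop),
      pd1_mul (by fun_prop) (by fun_prop), pd1_mul (by fun_prop) (by fun_prop), pd1_WW, pd1_const,
      pd1_fst]
    ring
  have b22 : ∀ z, pd2 (pd2 β) z = 2 * α z + 4 * z.2 * pd2 α z + WW z * pd2 (pd2 α) z := by
    intro z
    rw [b2, pd2_add (by fun_prop) (by fun_prop), pd2_mul (by fun_prop) (by fun_prop),
      pd2_mul (by fun_prop) (by fun_prop), pd2_mul (by fun_prop) (by fun_prop), pd2_WW, pd2_const,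
      pd2_snd]
    ring
  have b12 : ∀ z, pd1 (pd2 β) z = 2 * z.2 * pd1 α z + 2 * z.1 * pd2 α z + WW z * pd1 (pd2 α) z := by
    intro z
    rw [b2, pd1_add (by fun_prop) (by fun_prop), pd1_mul (by fun_prop) (by fun_prop),
      pd1_mul (by fun_prop) (by fun_prop), pd1_mul (by fun_prop) (by fun_prop), pd1_WW, pd1_const,
      pd1_snd]
    ring
  have e12 : pd1 (pd2 β) = fun _ => 0 := by
    ext z
    rw [b12]
    have := hV z
    unfold VV at this
    linear_combination (WW z / 2) * this - 2 * (z.1 * pd2 α z + z.2 * pd1 α z) * vW z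
  have e21 : pd2 (pd1 β) = fun _ => 0 := by
    ext z; rw [pd_comm hβ, e12]
  have e11 : pd1 (pd1 β) = pd2 (pd2 β) := by
    ext z
    rw [b11, b22]
    have := hU z
    unfold UU at this
    linear_combination (WW z) * this - 4 * (z.1 * pd1 α z - z.2 * pd2 α z) * vW z
  have g := const_of_pd hβ.p1.p1 (fun z => by rw [e11, ← pd_comm hβ.p2, e12, pd2_const])
    (fun z => by rw [pd_comm hβ.p1, e21, pd1_const])
  obtain ⟨A, hA⟩ : ∃ A, A = pd1 (pd1 β) 0 := ⟨_, rfl⟩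
  rw [← hA] at g
  have g2 : ∀ z, pd2 (pd2 β) z = A := fun z => by rw [← e11, g]
  have k1 := const_of_pd (f := fun z => pd1 β z - A * z.1) (by have := hβ.p1; fun_prop)
    (fun z => by
      rw [pd1_sub hβ.p1 (by fun_prop), g, pd1_mul (by fun_prop) (by fun_prop), pd1_const, pd1_fst]; ring)
    (fun z => by
      rw [pd2_sub hβ.p1 (by fun_prop), e21, pd2_mul (by fun_prop) (by fun_prop), pd2_const, pd2_fst]; ring)
  have k2 := const_of_pd (f := fun z => pd2 β z - A * z.2) (by have := hβ.p2; fun_prop)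
    (fun z => by
      rw [pd1_sub hβ.p2 (by fun_prop), e12, pd1_mul (by fun_prop) (by fun_prop), pd1_const, pd1_snd]; ring)
    (fun z => by
      rw [pd2_sub hβ.p2 (by fun_prop), g2, pd2_mul (by fun_prop) (by fun_prop), pd2_const, pd2_snd]; ring)
  simp only [Prod.fst_zero, Prod.snd_zero, mul_zero, sub_zero] at k1 k2
  obtain ⟨B, hB⟩ : ∃ B, B = pd1 β 0 := ⟨_, rfl⟩
  obtain ⟨C, hC⟩ : ∃ C, C = pd2 β 0 := ⟨_, rfl⟩
  rw [← hB] at k1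
  rw [← hC] at k2
  have k3 := const_of_pd
    (f := fun z => β z - ((A / 2) * (WW z) + B * z.1 + C * z.2)) (by fun_prop)
    (fun z => by
      rw [pd1_sub hβ (by fun_prop), pd1_add (by fun_prop) (by fun_prop),
        pd1_add (by fun_prop) (by fun_prop), pd1_mul (by fun_prop) (by fun_prop),
        pd1_mul (by fun_prop) (by fun_prop), pd1_mul (by fun_prop) (by fun_prop)]
      simp only [pd1_const, pd1_fst, pd1_snd, pd1_WW]
      linear_combination k1 z)
    (fun z => by
      rw [pd2_sub hβ (by fun_prop), pd2_add (by fun_prop) (by fun_prop),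
        pd2_add (by fun_prop) (by fun_prop), pd2_mul (by fun_prop) (by fun_prop),
        pd2_mul (by fun_prop) (by fun_prop), pd2_mul (by fun_prop) (by fun_prop)]
      simp only [pd2_const, pd2_fst, pd2_snd, pd2_WW]
      linear_combination k2 z)
  refine ⟨A / 2, B, C, fun z => ?_⟩
  have h3 := k3 z
  have i1 := b11 0
  have i2 := b22 0
  have i3 := he 0
  rw [g] at i1
  rw [g2] at i2
  simp only [hβd] at h3
  simp only [vv, WW, Prod.fst_zero, Prod.snd_zero] at *
  norm_num at *
  linear_combination h3 + i1 / 4 + i2 / 4 + i3 / 4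

lemma mvR (u v : ℝ × ℝ → ℝ) (hu : ContDiff ℝ (⊤ : ℕ∞) u) (hv : ContDiff ℝ (⊤ : ℕ∞) v)
    (hcr : ∀ z, pd1 u z = pd2 v z ∧ pd2 u z = - pd1 v z) (p : ℝ × ℝ) (R : ℝ) :
    ∫ z, bmp z * u (p + R • z) = (∫ z, bmp z) * u p := by
  obtain ⟨G, hG⟩ : ∃ G : ℂ → ℂ, G = fun ζ => (u (ζ.re, ζ.im) : ℂ) + (v (ζ.re, ζ.im) : ℂ) * Complex.I :=
    ⟨_, rfl⟩
  have hGd : Differentiable ℂ G := by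
    intro ζ
    have hl : HasFDerivAt (fun ζ : ℂ => (ζ.re, ζ.im)) (Complex.reCLM.prod Complex.imCLM) ζ :=
      (Complex.reCLM.prod Complex.imCLM).hasFDerivAt
    have h1 := ((hu.d (ζ.re, ζ.im)).hasFDerivAt.comp ζ hl)
    have h2 := ((hv.d (ζ.re, ζ.im)).hasFDerivAt.comp ζ hl)
    have h1' := (Complex.ofRealCLM.hasFDerivAt (x := u (ζ.re, ζ.im))).comp ζ h1
    have h2' := ((Complex.ofRealCLM.hasFDerivAt (x := v (ζ.re, ζ.im))).comp ζ h2).mul_const Complex.I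
    have h3 := h1'.add h2'
    rw [show _ + _ = G from by rw [hG]; rfl] at h3
    rw [differentiableAt_complex_iff_differentiableAt_real]
    refine ⟨h3.differentiableAt, ?_⟩
    rw [h3.fderiv]
    obtain ⟨c1, c2⟩ := hcr (ζ.re, ζ.im)
    apply Complex.ext <;> simp [fderiv_pd, c1, c2]
  have h := mv (fun ζ => G ((p.1 + p.2 * Complex.I) + R * ζ)) (by fun_prop)
  have h' := congrArg Complex.re h
  have hc : Continuous (fun z : ℝ × ℝ => (bmp z : ℂ) * G ((p.1 + p.2 * Complex.I) + R * (z.1 + z.2 * Complex.I))) := by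
    have := bmp_cont
    have := hGd.continuous
    fun_prop
  have hi : Integrable (fun z : ℝ × ℝ => (bmp z : ℂ) * G ((p.1 + p.2 * Complex.I) + R * (z.1 + z.2 * Complex.I))) := by
    apply hc.integrable_of_hasCompactSupport
    apply HasCompactSupport.mul_right
    exact bmp_supp.comp_left (g := fun x : ℝ => (x : ℂ)) (by simp)
  have e := Complex.reCLM.integral_comp_comm hi
  simp only [Complex.reCLM_apply] at e
  rw [← e] at h'
  simp only [hG, Complex.re_ofReal_mul] at h'
  have eq : ∀ z : ℝ × ℝ, p + R • z = (p.1 + R * z.1, p.2 + R * z.2) := fun z => by ext <;> simp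
  simp only [eq]
  simpa using h'

lemma comp_fderiv {g : ℝ × ℝ → ℝ} (hg : ContDiff ℝ (⊤ : ℕ∞) g) (p : ℝ × ℝ) (R : ℝ) (z w : ℝ × ℝ) :
    fderiv ℝ (fun z => g (p + R • z)) z w = R * fderiv ℝ g (p + R • z) w := by
  have hl : HasFDerivAt (fun z : ℝ × ℝ => p + R • z) (R • ContinuousLinearMap.id ℝ (ℝ × ℝ)) z :=
    ((hasFDerivAt_id z).const_smul R).const_add p
  have h1 := ((hg.d (p + R • z)).hasFDerivAt.comp z hl)
  have h2 : fderiv ℝ (fun z => g (p + R • z)) z = _ := h1.fderiv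
  rw [h2]
  simp

lemma dbmp_cont (w : ℝ × ℝ) : Continuous (fun z => fderiv ℝ bmp z w) :=
  (bmp_smooth.continuous_fderiv (by simp)).clm_apply continuous_const

lemma bint (g : ℝ × ℝ → ℝ) (hg : Continuous g) (p : ℝ × ℝ) (R : ℝ) :
    Integrable (fun z => bmp z * g (p + R • z)) := by
  have := bmp_cont
  exact Continuous.integrable_of_hasCompactSupport (by fun_prop) bmp_supp.mul_right

lemma dbint (w : ℝ × ℝ) (g : ℝ × ℝ → ℝ) (hg : Continuous g) (p : ℝ × ℝ) (R : ℝ) :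
    Integrable (fun z => fderiv ℝ bmp z w * g (p + R • z)) := by
  have := dbmp_cont w
  exact Continuous.integrable_of_hasCompactSupport (by fun_prop)
    (bmp_supp.fderiv_apply (𝕜 := ℝ) w).mul_right

lemma ibp {g : ℝ × ℝ → ℝ} (hg : ContDiff ℝ (⊤ : ℕ∞) g) (p : ℝ × ℝ) (R : ℝ) (hR : R ≠ 0) (w : ℝ × ℝ) :
    ∫ z, bmp z * fderiv ℝ g (p + R • z) w = ∫ z, - (R⁻¹ * (fderiv ℝ bmp z w * g (p + R • z))) := by
  have hgc := hg.continuous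
  have hgd : Continuous (fun z => fderiv ℝ g z w) :=
    (hg.continuous_fderiv (by simp)).clm_apply continuous_const
  have hd : Differentiable ℝ (fun z => g (p + R • z)) := hg.d.comp (by fun_prop)
  have h := integral_mul_fderiv_eq_neg_fderiv_mul_of_integrable (μ := volume) (f := bmp)
    (g := fun z => g (p + R • z)) (v := w)
    (dbint w g hgc p R)
    (by
      simp only [comp_fderiv hg]
      exact ((bint _ hgd p R).const_mul R).congr (Filter.Eventually.of_forall fun z => by
        simp only; ring))
    (bint g hgc p R)
    (fun x _ => bmp_smooth.d x) (fun x _ => hd x)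
  simp only [comp_fderiv hg] at h
  rw [integral_neg, integral_const_mul]
  have e : ∫ z, bmp z * (R * fderiv ℝ g (p + R • z) w) = R * ∫ z, bmp z * fderiv ℝ g (p + R • z) w := by
    rw [← integral_const_mul]
    congr 1
    ext z
    ring
  rw [e] at h
  field_simp
  linarith

def Hh (z : ℝ × ℝ) : ℝ := |pd1 bmp z| + |pd2 bmp z| + |bmp z|

lemma Hh_int : Integrable (fun z => Hh z ^ 2) := by
  have h1 : Continuous (pd1 bmp) := dbmp_cont _
  have h2 : Continuous (pd2 bmp) := dbmp_cont _
  have h3 := bmp_cont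
  have s1 : HasCompactSupport (pd1 bmp) := bmp_supp.fderiv_apply (𝕜 := ℝ) _
  have s2 : HasCompactSupport (pd2 bmp) := bmp_supp.fderiv_apply (𝕜 := ℝ) _
  refine Continuous.integrable_of_hasCompactSupport (by unfold Hh; fun_prop) ?_
  have s : HasCompactSupport Hh := by
    unfold Hh
    exact (s1.abs.add s2.abs).add bmp_supp.abs
  exact s.comp_left (g := fun x : ℝ => x ^ 2) (by simp)

lemma est (a b : ℝ × ℝ → ℝ) (hi : Integrable (fun z => a z ^ 2 + b z ^ 2)) (p : ℝ × ℝ) (R : ℝ)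
    (hR : 0 < R) (N : ℝ × ℝ → ℝ)
    (hN : ∀ z, |N z| ≤ 2 * (|a (p + R • z)| + |b (p + R • z)|) * Hh z) :
    |∫ z, N z| ≤ ((∫ z, a z ^ 2 + b z ^ 2) + 2 * ∫ z, Hh z ^ 2) / R := by
  have i1 : Integrable (fun z => a (p + R • z) ^ 2 + b (p + R • z) ^ 2) :=
    (hi.comp_add_left p).comp_smul hR.ne'
  have e1 : ∫ z, (a (p + R • z) ^ 2 + b (p + R • z) ^ 2) = (R ^ 2)⁻¹ * ∫ z, a z ^ 2 + b z ^ 2 := by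
    rw [Measure.integral_comp_smul volume (fun z => a (p + z) ^ 2 + b (p + z) ^ 2) R,
      integral_add_left_eq_self (fun z => a z ^ 2 + b z ^ 2) p]
    simp
  have h := norm_integral_le_of_norm_le
    (g := fun z => R * (a (p + R • z) ^ 2 + b (p + R • z) ^ 2) + 2 / R * Hh z ^ 2) (f := N)
    ((i1.const_mul R).add (Hh_int.const_mul (2 / R)))
    (Filter.Eventually.of_forall fun z => by
      refine (hN z).trans ?_
      rw [← sq_abs (a _), ← sq_abs (b _)]
      set x := |a (p + R • z)|
      set y := |b (p + R • z)|
      have k : R * (x ^ 2 + y ^ 2) + 2 / R * Hh z ^ 2 - 2 * (x + y) * Hh z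
        = ((R * x - Hh z) ^ 2 + (R * y - Hh z) ^ 2) / R := by
        field_simp; ring
      have : 0 ≤ ((R * x - Hh z) ^ 2 + (R * y - Hh z) ^ 2) / R := by positivity
      linarith)
  rw [integral_add (i1.const_mul R) (Hh_int.const_mul (2 / R)), integral_const_mul,
    integral_const_mul, e1] at h
  rw [Real.norm_eq_abs] at h
  refine h.trans (le_of_eq ?_)
  field_simp

lemma vanish (x K m : ℝ) (hm : 0 < m) (h : ∀ R : ℝ, 1 ≤ R → |m * x| ≤ K / R) : x = 0 := by
  by_contra hx
  have h0 : 0 < |m * x| := abs_pos.2 (mul_ne_zero hm.ne' hx)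
  have h1 := h 1 le_rfl
  rw [div_one] at h1
  have hR : 1 ≤ K / |m * x| + 1 := by
    have : 0 ≤ K / |m * x| := div_nonneg (h0.le.trans h1) h0.le
    linarith
  have h2 := h _ hR
  rw [le_div_iff₀ (by linarith)] at h2
  have : |m * x| * (K / |m * x| + 1) = K + |m * x| := by field_simp
  linarith

lemma vx (z : ℝ × ℝ) : 2 * (vv z * |z.1|) ≤ 1 ∧ 2 * (vv z * |z.2|) ≤ 1 := by
  have hp := WW_pos z
  constructor
  · rw [vv, ← div_eq_inv_mul, ← mul_div_assoc, div_le_one hp]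
    unfold WW
    nlinarith [sq_nonneg (|z.1| - 1), abs_mul_abs_self z.1, mul_self_nonneg z.2]
  · rw [vv, ← div_eq_inv_mul, ← mul_div_assoc, div_le_one hp]
    unfold WW
    nlinarith [sq_nonneg (|z.2| - 1), abs_mul_abs_self z.2, mul_self_nonneg z.1]

lemma abs_aux (v x a : ℝ) (hv : 0 ≤ v) (h : 2 * (v * |x|) ≤ 1) : |4 * (v * (x * a))| ≤ 2 * |a| := by
  rw [abs_mul, abs_mul, abs_mul, abs_of_nonneg hv]
  norm_num
  nlinarith [abs_nonneg a]

lemma U_zero {α : ℝ × ℝ → ℝ} (h : ContDiff ℝ (⊤ : ℕ∞) α)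
    (hi : Integrable (fun z : ℝ × ℝ => pd1 α z ^ 2 + pd2 α z ^ 2))
    (hcr : ∀ z, pd1 (UU α) z = - pd2 (VV α) z ∧ pd2 (UU α) z = pd1 (VV α) z) (p) :
    UU α p = 0 := by
  have h1 := h.p1; have h2 := h.p2; have h11 := h1.p1; have h22 := h2.p2
  have c1 := h1.continuous; have c2 := h2.continuous
  have c11 := h11.continuous; have c22 := h22.continuous; have cv := vv_sm.continuous
  refine vanish _ ((∫ z, pd1 α z ^ 2 + pd2 α z ^ 2) + 2 * ∫ z, Hh z ^ 2) _ bmp_int_pos (fun R hR => ?_)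
  have hR0 : 0 < R := by linarith
  have hV := VV_sm h
  rw [← mvR (UU α) (fun z => - VV α z) (UU_sm h) hV.neg (fun z => by
    have := hcr z
    have e1 : pd1 (fun z => - VV α z) z = - pd1 (VV α) z := by simp [pd1]
    have e2 : pd2 (fun z => - VV α z) z = - pd2 (VV α) z := by simp [pd2]
    rw [e1, e2, this.1, this.2]; simp) p R]
  have j1 := ibp h1 p R hR0.ne' (1, 0)
  have j2 := ibp h2 p R hR0.ne' (0, 1)
  have k1 := bint (pd1 (pd1 α)) c11 p R
  have k2 := bint (pd2 (pd2 α)) c22 p R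
  have k3 := bint (fun z => 4 * (vv z * (z.1 * pd1 α z - z.2 * pd2 α z))) (by fun_prop) p R
  have l1 := ((dbint (1, 0) _ c1 p R).const_mul R⁻¹).neg
  have l2 := ((dbint (0, 1) _ c2 p R).const_mul R⁻¹).neg
  have e : ∫ z, bmp z * UU α (p + R • z) = ∫ z, (
      - (R⁻¹ * (pd1 bmp z * pd1 α (p + R • z))) - - (R⁻¹ * (pd2 bmp z * pd2 α (p + R • z)))
      + bmp z * (4 * (vv (p + R • z) * ((p + R • z).1 * pd1 α (p + R • z) -
        (p + R • z).2 * pd2 α (p + R • z))))) := by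
    have e1 : ∫ z, bmp z * UU α (p + R • z) = ∫ z, (bmp z * pd1 (pd1 α) (p + R • z)
      - bmp z * pd2 (pd2 α) (p + R • z)
      + bmp z * (4 * (vv (p + R • z) * ((p + R • z).1 * pd1 α (p + R • z) -
        (p + R • z).2 * pd2 α (p + R • z))))) := by
      congr 1
      ext z
      unfold UU
      ring
    rw [e1]
    refine (integral_add (k1.sub k2) k3).trans ?_
    refine Eq.trans ?_ (integral_add (l1.sub l2) k3).symm
    congr 1
    refine (integral_sub k1 k2).trans ?_
    refine Eq.trans ?_ (integral_sub l1 l2).symm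
    exact congrArg₂ _ j1 j2
  rw [e]
  refine est (pd1 α) (pd2 α) hi p R hR0 _ (fun z => ?_)
  set q := p + R • z
  obtain ⟨vx1, vx2⟩ := vx q
  have v0 : 0 ≤ vv q := (inv_pos.2 (WW_pos q)).le
  have a1 := abs_aux (vv q) q.1 (pd1 α q) v0 vx1
  have a2 := abs_aux (vv q) q.2 (pd2 α q) v0 vx2
  have r1 : R⁻¹ ≤ 1 := inv_le_one_of_one_le₀ hR
  have r0 : 0 < R⁻¹ := by positivity
  have t1 : |R⁻¹ * (pd1 bmp z * pd1 α q)| ≤ |pd1 bmp z| * |pd1 α q| := by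
    rw [abs_mul, abs_mul, abs_of_pos r0]
    exact mul_le_of_le_one_left (by positivity) r1
  have t2 : |R⁻¹ * (pd2 bmp z * pd2 α q)| ≤ |pd2 bmp z| * |pd2 α q| := by
    rw [abs_mul, abs_mul, abs_of_pos r0]
    exact mul_le_of_le_one_left (by positivity) r1
  have t3 : |bmp z * (4 * (vv q * (q.1 * pd1 α q - q.2 * pd2 α q)))| ≤
      |bmp z| * (2 * |pd1 α q| + 2 * |pd2 α q|) := by
    rw [abs_mul]
    gcongr
    have : 4 * (vv q * (q.1 * pd1 α q - q.2 * pd2 α q)) =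
      4 * (vv q * (q.1 * pd1 α q)) - 4 * (vv q * (q.2 * pd2 α q)) := by ring
    rw [this]
    exact (abs_sub _ _).trans (add_le_add a1 a2)
  refine (abs_add_le _ _).trans ?_
  refine (add_le_add ((abs_sub _ _).trans (add_le_add (abs_neg _).le (abs_neg _).le)) t3).trans ?_
  unfold Hh
  have p1 := mul_nonneg (abs_nonneg (pd1 bmp z)) (abs_nonneg (pd1 α q))
  have p2 := mul_nonneg (abs_nonneg (pd1 bmp z)) (abs_nonneg (pd2 α q))
  have p3 := mul_nonneg (abs_nonneg (pd2 bmp z)) (abs_nonneg (pd1 α q))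
  have p4 := mul_nonneg (abs_nonneg (pd2 bmp z)) (abs_nonneg (pd2 α q))
  nlinarith

lemma V_zero {α : ℝ × ℝ → ℝ} (h : ContDiff ℝ (⊤ : ℕ∞) α)
    (hi : Integrable (fun z : ℝ × ℝ => pd1 α z ^ 2 + pd2 α z ^ 2))
    (hcr : ∀ z, pd1 (UU α) z = - pd2 (VV α) z ∧ pd2 (UU α) z = pd1 (VV α) z) (p) :
    VV α p = 0 := by
  have h1 := h.p1; have h2 := h.p2; have h12 := h2.p1
  have c1 := h1.continuous; have c2 := h2.continuous
  have c12 := h12.continuous; have cv := vv_sm.continuous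
  refine vanish _ ((∫ z, pd1 α z ^ 2 + pd2 α z ^ 2) + 2 * ∫ z, Hh z ^ 2) _ bmp_int_pos (fun R hR => ?_)
  have hR0 : 0 < R := by linarith
  rw [← mvR (VV α) (UU α) (VV_sm h) (UU_sm h) (fun z => by
    have := hcr z
    rw [this.1, this.2]; simp) p R]
  have j1 := ibp h2 p R hR0.ne' (1, 0)
  have k1 := bint (pd1 (pd2 α)) c12 p R
  have k3 := bint (fun z => 4 * (vv z * (z.1 * pd2 α z + z.2 * pd1 α z))) (by fun_prop) p R
  have l1 := ((dbint (1, 0) _ c2 p R).const_mul R⁻¹).neg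
  have e : ∫ z, bmp z * VV α (p + R • z) = ∫ z, (
      2 * - (R⁻¹ * (pd1 bmp z * pd2 α (p + R • z)))
      + bmp z * (4 * (vv (p + R • z) * ((p + R • z).1 * pd2 α (p + R • z) +
        (p + R • z).2 * pd1 α (p + R • z))))) := by
    have e1 : ∫ z, bmp z * VV α (p + R • z) = ∫ z, (2 * (bmp z * pd1 (pd2 α) (p + R • z))
      + bmp z * (4 * (vv (p + R • z) * ((p + R • z).1 * pd2 α (p + R • z) +
        (p + R • z).2 * pd1 α (p + R • z))))) := by
      congr 1
      ext z
      unfold VV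
      ring
    rw [e1, integral_add (k1.const_mul 2) k3, integral_const_mul]
    refine Eq.trans ?_ (integral_add (l1.const_mul 2) k3).symm
    congr 1
    refine Eq.trans ?_ (integral_const_mul _ _).symm
    exact congrArg _ j1
  rw [e]
  refine est (pd1 α) (pd2 α) hi p R hR0 _ (fun z => ?_)
  set q := p + R • z
  obtain ⟨vx1, vx2⟩ := vx q
  have v0 : 0 ≤ vv q := (inv_pos.2 (WW_pos q)).le
  have a1 := abs_aux (vv q) q.1 (pd2 α q) v0 vx1
  have a2 := abs_aux (vv q) q.2 (pd1 α q) v0 vx2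
  have r1 : R⁻¹ ≤ 1 := inv_le_one_of_one_le₀ hR
  have r0 : 0 < R⁻¹ := by positivity
  have t1 : |2 * - (R⁻¹ * (pd1 bmp z * pd2 α q))| ≤ 2 * (|pd1 bmp z| * |pd2 α q|) := by
    rw [abs_mul, abs_neg, abs_mul, abs_mul, abs_of_pos r0, abs_of_pos (by norm_num : (0:ℝ) < 2)]
    exact mul_le_mul_of_nonneg_left (mul_le_of_le_one_left (by positivity) r1) (by norm_num)
  have t3 : |bmp z * (4 * (vv q * (q.1 * pd2 α q + q.2 * pd1 α q)))| ≤
      |bmp z| * (2 * |pd2 α q| + 2 * |pd1 α q|) := by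
    rw [abs_mul]
    gcongr
    have : 4 * (vv q * (q.1 * pd2 α q + q.2 * pd1 α q)) =
      4 * (vv q * (q.1 * pd2 α q)) + 4 * (vv q * (q.2 * pd1 α q)) := by ring
    rw [this]
    exact (abs_add_le _ _).trans (add_le_add a1 a2)
  refine (abs_add_le _ _).trans ?_
  refine (add_le_add t1 t3).trans ?_
  unfold Hh
  have p1 := mul_nonneg (abs_nonneg (pd1 bmp z)) (abs_nonneg (pd1 α q))
  have p2 := mul_nonneg (abs_nonneg (pd1 bmp z)) (abs_nonneg (pd2 α q))
  have p3 := mul_nonneg (abs_nonneg (pd2 bmp z)) (abs_nonneg (pd1 α q))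
  have p4 := mul_nonneg (abs_nonneg (pd2 bmp z)) (abs_nonneg (pd2 α q))
  nlinarith

theorem first_eigenfunctions_classification (α : ℝ × ℝ → ℝ)
    (hsmooth : ContDiff ℝ (⊤ : ℕ∞) α)
    (hbdd : ∃ C : ℝ, ∀ z, |α z| ≤ C)
    (hdirichlet : Integrable (fun z : ℝ × ℝ => pd1 α z ^ 2 + pd2 α z ^ 2))
    (heigen : ∀ z : ℝ × ℝ, lap α z + (8 / (1 + z.1 ^ 2 + z.2 ^ 2) ^ 2) * α z = 0) :
    ∃ c₀ c₁ c₂ : ℝ, ∀ z, α z = c₀ * psi0 z + c₁ * psi1 z + c₂ * psi2 z := by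
  have he : ∀ z, pd1 (pd1 α) z + pd2 (pd2 α) z = - 8 * (vv z * vv z * α z) := by
    intro z
    have h1 := heigen z
    have h2 : 8 / (1 + z.1 ^ 2 + z.2 ^ 2) ^ 2 = 8 * (vv z * vv z) := by
      unfold vv WW
      rw [div_eq_mul_inv]
      congr 1
      rw [← mul_inv]
      congr 1
      ring
    rw [h2] at h1
    unfold lap at h1
    linear_combination h1
  have hcr := CR hsmooth he
  obtain ⟨a, b, c, h⟩ := final hsmooth he (U_zero hsmooth hdirichlet hcr) (V_zero hsmooth hdirichlet hcr)
  refine ⟨-a, b, c, fun z => ?_⟩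
  have hz := h z
  have hp := WW_pos z
  have hW : 1 + z.1 ^ 2 + z.2 ^ 2 = WW z := by unfold WW; ring
  unfold psi0 psi1 psi2
  rw [hW]
  field_simp
  linear_combination hz

end
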